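/- arXiv:2506.10118 — 7 statements merged into one kernel-verified Lean document; each statement's English description precedes it below -/
import Mathlib

section
/- Let M, K ∈ ℂ^{n×n}, B ∈ ℂ^{n×m}, C_p, C_v ∈ ℂ^{p×n}, let f, g : ℂ → ℂ, and define φ(s) = s²M + s(f(s)M + g(s)K) + K, d(s) = 1 + s·g(s), n(s) = s² + s·f(s), h(s) = n(s)/d(s), and the transfer functions G(s) = (C_p + sC_v)φ(s)⁻¹B, G_p(s) = C_p φ(s)⁻¹ B, G_v(s) = s C_v φ(s)⁻¹ B. Let θ, ζ ∈ ℝ with ζ ≠ 0, d(iθ) ≠ 0, d(iζ) ≠ 0, h(iθ) ≠ h(iζ), and suppose φ(iθ) and φ(iζ) are invertible. Then (C_p + iθ C_v) φ(iθ)⁻¹ M φ(iζ)⁻¹ B = −(d(iθ)d(iζ))⁻¹ · ( d(iθ)G(iθ) − d(iζ)( G_p(iζ) + (θ/ζ) G_v(iζ) ) ) / ( h(iθ) − h(iζ) ). -/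
open Matrix Complex

/-- The second-order resolvent pencil with generalized proportional damping
`D(s) = f(s)M + g(s)K`: `φ(s) = s²M + s(f(s)M + g(s)K) + K`. -/
noncomputable def phi {n : ℕ} (M K : Matrix (Fin n) (Fin n) ℂ) (f g : ℂ → ℂ) (s : ℂ) :
    Matrix (Fin n) (Fin n) ℂ :=
  s ^ 2 • M + s • (f s • M + g s • K) + K

/-- `d(s) = 1 + s·g(s)`. -/
noncomputable def dfun (g : ℂ → ℂ) (s : ℂ) : ℂ := 1 + s * g s

/-- `n(s) = s² + s·f(s)`. -/
noncomputable def nfun (f : ℂ → ℂ) (s : ℂ) : ℂ := s ^ 2 + s * f s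

/-- `h(s) = n(s)/d(s)`. -/
noncomputable def hfun (f g : ℂ → ℂ) (s : ℂ) : ℂ := nfun f s / dfun g s

/-- Full transfer function `G(s) = (C_p + s C_v) φ(s)⁻¹ B`. -/
noncomputable def Gfull {n m p : ℕ} (M K : Matrix (Fin n) (Fin n) ℂ)
    (B : Matrix (Fin n) (Fin m) ℂ) (Cp Cv : Matrix (Fin p) (Fin n) ℂ)
    (f g : ℂ → ℂ) (s : ℂ) : Matrix (Fin p) (Fin m) ℂ :=
  (Cp + s • Cv) * (phi M K f g s)⁻¹ * B

/-- Position-output transfer function `G_p(s) = C_p φ(s)⁻¹ B`. -/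
noncomputable def Gpos {n m p : ℕ} (M K : Matrix (Fin n) (Fin n) ℂ)
    (B : Matrix (Fin n) (Fin m) ℂ) (Cp : Matrix (Fin p) (Fin n) ℂ)
    (f g : ℂ → ℂ) (s : ℂ) : Matrix (Fin p) (Fin m) ℂ :=
  Cp * (phi M K f g s)⁻¹ * B

/-- Velocity-output transfer function `G_v(s) = s C_v φ(s)⁻¹ B`. -/
noncomputable def Gvel {n m p : ℕ} (M K : Matrix (Fin n) (Fin n) ℂ)
    (B : Matrix (Fin n) (Fin m) ℂ) (Cv : Matrix (Fin p) (Fin n) ℂ)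
    (f g : ℂ → ℂ) (s : ℂ) : Matrix (Fin p) (Fin m) ℂ :=
  s • (Cv * (phi M K f g s)⁻¹ * B)

theorem phi_eq_nfun_smul_add_dfun_smul {n : ℕ} (M K : Matrix (Fin n) (Fin n) ℂ) (f g : ℂ → ℂ)
    (s : ℂ) : phi M K f g s = nfun f s • M + dfun g s • K := by
  unfold phi nfun dfun
  module

/-- The resolvent identity for the pencil `phi`, with the mass matrix in the middle. -/
theorem smul_inv_phi_mul_mass_mul_inv_phi {n : ℕ} (M K : Matrix (Fin n) (Fin n) ℂ) (f g : ℂ → ℂ)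
    {s t : ℂ} (hds : dfun g s ≠ 0) (hdt : dfun g t ≠ 0)
    (hs : IsUnit (phi M K f g s)) (ht : IsUnit (phi M K f g t)) :
    (dfun g s * dfun g t * (hfun f g s - hfun f g t)) •
        ((phi M K f g s)⁻¹ * M * (phi M K f g t)⁻¹) =
      dfun g t • (phi M K f g t)⁻¹ - dfun g s • (phi M K f g s)⁻¹ := by
  have hM : (dfun g s * dfun g t * (hfun f g s - hfun f g t)) • M =
      dfun g t • phi M K f g s - dfun g s • phi M K f g t := by
    have hc : dfun g s * dfun g t * (hfun f g s - hfun f g t) =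
        dfun g t * nfun f s - dfun g s * nfun f t := by
      unfold hfun
      field_simp
    rw [hc, phi_eq_nfun_smul_add_dfun_smul, phi_eq_nfun_smul_add_dfun_smul]
    module
  rw [← Matrix.smul_mul, ← Matrix.mul_smul, hM, Matrix.mul_sub, Matrix.sub_mul,
    Matrix.mul_smul, Matrix.mul_smul, Matrix.smul_mul, Matrix.smul_mul,
    Matrix.nonsing_inv_mul _ ((Matrix.isUnit_iff_isUnit_det _).mp hs), Matrix.one_mul,
    Matrix.mul_assoc, Matrix.mul_nonsing_inv _ ((Matrix.isUnit_iff_isUnit_det _).mp ht),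
    Matrix.mul_one]

/-- The `𝕄`-block formula of Theorem 3.2 (data-driven expression of
`(C_p + iθ C_v) φ(iθ)⁻¹ M φ(iζ)⁻¹ B`). -/
theorem M_block_from_data {n m p : ℕ} (M K : Matrix (Fin n) (Fin n) ℂ)
    (B : Matrix (Fin n) (Fin m) ℂ) (Cp Cv : Matrix (Fin p) (Fin n) ℂ)
    (f g : ℂ → ℂ) (θ ζ : ℝ) (hζ : ζ ≠ 0)
    (hdθ : dfun g (I * θ) ≠ 0) (hdζ : dfun g (I * ζ) ≠ 0)
    (hh : hfun f g (I * θ) ≠ hfun f g (I * ζ))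
    (hφθ : IsUnit (phi M K f g (I * θ))) (hφζ : IsUnit (phi M K f g (I * ζ))) :
    (Cp + (I * θ) • Cv) * (phi M K f g (I * θ))⁻¹ * M * (phi M K f g (I * ζ))⁻¹ * B =
      (-(dfun g (I * θ) * dfun g (I * ζ))⁻¹ *
          (hfun f g (I * θ) - hfun f g (I * ζ))⁻¹) •
        (dfun g (I * θ) • Gfull M K B Cp Cv f g (I * θ) -
          dfun g (I * ζ) •
            (Gpos M K B Cp f g (I * ζ) +
              ((θ : ℂ) / (ζ : ℂ)) • Gvel M K B Cv f g (I * ζ))) := by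
  have hζ' : (ζ : ℂ) ≠ 0 := ofReal_ne_zero.mpr hζ
  have hout : Gpos M K B Cp f g (I * ζ) + ((θ : ℂ) / (ζ : ℂ)) • Gvel M K B Cv f g (I * ζ) =
      (Cp + (I * θ) • Cv) * (phi M K f g (I * ζ))⁻¹ * B := by
    have hc : (θ : ℂ) / ζ * (I * ζ) = I * θ := by field_simp
    simp only [Gpos, Gvel, smul_smul, hc, Matrix.add_mul, Matrix.smul_mul]
  have hdiff : dfun g (I * θ) • Gfull M K B Cp Cv f g (I * θ) -
      dfun g (I * ζ) • ((Cp + (I * θ) • Cv) * (phi M K f g (I * ζ))⁻¹ * B) =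
      -((dfun g (I * θ) * dfun g (I * ζ) * (hfun f g (I * θ) - hfun f g (I * ζ))) •
        ((Cp + (I * θ) • Cv) * (phi M K f g (I * θ))⁻¹ * M * (phi M K f g (I * ζ))⁻¹ * B)) := by
    have hres := congrArg (fun X => (Cp + (I * θ) • Cv) * X * B)
      (smul_inv_phi_mul_mass_mul_inv_phi M K f g hdθ hdζ hφθ hφζ)
    simp only [Matrix.mul_sub, Matrix.sub_mul, Matrix.mul_smul, Matrix.smul_mul,
      ← Matrix.mul_assoc] at hres
    rw [hres, Gfull, neg_sub]
  have hΔ : hfun f g (I * θ) - hfun f g (I * ζ) ≠ 0 := sub_ne_zero.mpr hh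
  rw [hout, hdiff, smul_neg, ← neg_smul, smul_smul]
  convert (one_smul ℂ _).symm using 2
  field_simp
end

section
/- Let M, K ∈ ℂ^{n×n}, B ∈ ℂ^{n×m}, C_p, C_v ∈ ℂ^{p×n}, let f, g : ℂ → ℂ, and define φ(s) = s²M + s(f(s)M + g(s)K) + K, d(s) = 1 + s·g(s), n(s) = s² + s·f(s), h(s) = n(s)/d(s), and the transfer functions G(s) = (C_p + sC_v)φ(s)⁻¹B, G_p(s) = C_p φ(s)⁻¹ B, G_v(s) = s C_v φ(s)⁻¹ B. Let θ, ζ ∈ ℝ with ζ ≠ 0, d(iθ) ≠ 0, d(iζ) ≠ 0, h(iθ) ≠ h(iζ), and suppose φ(iθ) and φ(iζ) are invertible. Then (C_p + iθ C_v) φ(iθ)⁻¹ K φ(iζ)⁻¹ B = (d(iθ)d(iζ))⁻¹ · ( n(iθ)G(iθ) − n(iζ)( G_p(iζ) + (θ/ζ) G_v(iζ) ) ) / ( h(iθ) − h(iζ) ). -/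
open Matrix Complex

theorem nfun_smul_phi_sub_nfun_smul_phi {n : ℕ} (M K : Matrix (Fin n) (Fin n) ℂ)
    (f g : ℂ → ℂ) (s t : ℂ) :
    nfun f s • phi M K f g t - nfun f t • phi M K f g s =
      (nfun f s * dfun g t - nfun f t * dfun g s) • K := by
  simp only [phi_eq_nfun_smul_add_dfun_smul]
  module

theorem smul_inv_phi_mul_mul_inv_phi {n : ℕ} (M K : Matrix (Fin n) (Fin n) ℂ)
    (f g : ℂ → ℂ) {s t : ℂ} (hs : IsUnit (phi M K f g s)) (ht : IsUnit (phi M K f g t)) :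
    (nfun f s * dfun g t - nfun f t * dfun g s) •
        ((phi M K f g s)⁻¹ * K * (phi M K f g t)⁻¹) =
      nfun f s • (phi M K f g s)⁻¹ - nfun f t • (phi M K f g t)⁻¹ := by
  rw [isUnit_iff_isUnit_det] at hs ht
  rw [← Matrix.smul_mul, ← Matrix.mul_smul, ← nfun_smul_phi_sub_nfun_smul_phi]
  simp only [Matrix.mul_sub, Matrix.sub_mul, Matrix.mul_smul, Matrix.smul_mul]
  rw [mul_nonsing_inv_cancel_right _ _ ht, nonsing_inv_mul _ hs, Matrix.one_mul]

theorem dfun_mul_dfun_mul_hfun_sub_hfun (f g : ℂ → ℂ) {s t : ℂ}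
    (hs : dfun g s ≠ 0) (ht : dfun g t ≠ 0) :
    dfun g s * dfun g t * (hfun f g s - hfun f g t) =
      nfun f s * dfun g t - nfun f t * dfun g s := by
  unfold hfun
  field_simp

/-- The `𝕂`-block formula of Theorem 3.2 (data-driven expression of
`(C_p + iθ C_v) φ(iθ)⁻¹ K φ(iζ)⁻¹ B`). -/
theorem K_block_from_data {n m p : ℕ} (M K : Matrix (Fin n) (Fin n) ℂ)
    (B : Matrix (Fin n) (Fin m) ℂ) (Cp Cv : Matrix (Fin p) (Fin n) ℂ)
    (f g : ℂ → ℂ) (θ ζ : ℝ) (hζ : ζ ≠ 0)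
    (hdθ : dfun g (I * θ) ≠ 0) (hdζ : dfun g (I * ζ) ≠ 0)
    (hh : hfun f g (I * θ) ≠ hfun f g (I * ζ))
    (hφθ : IsUnit (phi M K f g (I * θ))) (hφζ : IsUnit (phi M K f g (I * ζ))) :
    (Cp + (I * θ) • Cv) * (phi M K f g (I * θ))⁻¹ * K * (phi M K f g (I * ζ))⁻¹ * B =
      ((dfun g (I * θ) * dfun g (I * ζ))⁻¹ *
          (hfun f g (I * θ) - hfun f g (I * ζ))⁻¹) •
        (nfun f (I * θ) • Gfull M K B Cp Cv f g (I * θ) -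
          nfun f (I * ζ) •
            (Gpos M K B Cp f g (I * ζ) +
              ((θ : ℂ) / (ζ : ℂ)) • Gvel M K B Cv f g (I * ζ))) := by
  have hζ' : (ζ : ℂ) ≠ 0 := by exact_mod_cast hζ
  have hvel : (θ : ℂ) / ζ * (I * ζ) = I * θ := by field_simp
  have houtput : Gpos M K B Cp f g (I * ζ) + ((θ : ℂ) / ζ) • Gvel M K B Cv f g (I * ζ) =
      (Cp + (I * θ) • Cv) * (phi M K f g (I * ζ))⁻¹ * B := by
    simp only [Gpos, Gvel, smul_smul, hvel, Matrix.add_mul, Matrix.smul_mul]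
  rw [houtput, Gfull, ← mul_inv, eq_inv_smul_iff₀
    (mul_ne_zero (mul_ne_zero hdθ hdζ) (sub_ne_zero.mpr hh)),
    dfun_mul_dfun_mul_hfun_sub_hfun f g hdθ hdζ]
  have key := congrArg (fun X => (Cp + (I * θ) • Cv) * X * B)
    (smul_inv_phi_mul_mul_inv_phi M K f g hφθ hφζ)
  simpa only [Matrix.mul_sub, Matrix.sub_mul, Matrix.mul_smul, Matrix.smul_mul, ← Matrix.mul_assoc] using key
end

section
/- Let M, K ∈ ℂ^{n×n}, B ∈ ℂ^{n×m}, C_p ∈ ℂ^{p×n}, and let f, g : ℂ → ℂ be differentiable at a point s₀ ∈ ℂ. Define φ(s) = s²M + s(f(s)M + g(s)K) + K, d(s) = 1 + s·g(s), n(s) = s² + s·f(s), h(s) = n(s)/d(s), and G(s) = C_p φ(s)⁻¹ B. Suppose d(s₀) ≠ 0, φ(s₀) is invertible, and h'(s₀) ≠ 0, where h'(s₀) is the complex derivative of h at s₀. Then C_p φ(s₀)⁻¹ M φ(s₀)⁻¹ B = −d(s₀)⁻² · ((d·G)'(s₀)) · (h'(s₀))⁻¹, where (d·G)'(s₀) denotes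 the entrywise complex derivative of the matrix-valued function s ↦ d(s)G(s) at s₀. -/
open Matrix Complex

/-- Transfer function with position-only output: `G(s) = C_p φ(s)⁻¹ B`. -/
noncomputable def Gtf {n m p : ℕ} (M K : Matrix (Fin n) (Fin n) ℂ)
    (B : Matrix (Fin n) (Fin m) ℂ) (Cp : Matrix (Fin p) (Fin n) ℂ)
    (f g : ℂ → ℂ) (s : ℂ) : Matrix (Fin p) (Fin m) ℂ :=
  Cp * (phi M K f g s)⁻¹ * B

section

open scoped Matrix.Norms.Operator

/-- The derivative of the inverse of a matrix-valued function of one complex variable. -/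
theorem HasDerivAt.matrix_inv {n : ℕ} {A : ℂ → Matrix (Fin n) (Fin n) ℂ}
    {A' : Matrix (Fin n) (Fin n) ℂ} {s : ℂ} (hA : HasDerivAt A A' s) (hu : IsUnit (A s)) :
    HasDerivAt (fun t => (A t)⁻¹) (-((A s)⁻¹ * A' * (A s)⁻¹)) s := by
  obtain ⟨u, hu⟩ := hu
  have hinv := hasFDerivAt_ringInverse (𝕜 := ℂ) u
  rw [hu] at hinv
  have h := hinv.comp_hasDerivAt s hA
  simp only [Function.comp_def, ← Matrix.nonsing_inv_eq_ringInverse] at h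
  refine HasDerivAt.congr_deriv h ?_
  simp [← hu]

/-- The entrywise derivative of `s ↦ C (h(s) M + K)⁻¹ B`. -/
theorem hasDerivAt_mul_resolvent_mul_apply {n m p : ℕ} (M K : Matrix (Fin n) (Fin n) ℂ)
    (B : Matrix (Fin n) (Fin m) ℂ) (C : Matrix (Fin p) (Fin n) ℂ) {h : ℂ → ℂ} {h' s : ℂ}
    (hh : HasDerivAt h h' s) (hu : IsUnit (h s • M + K)) (i : Fin p) (j : Fin m) :
    HasDerivAt (fun t => (C * (h t • M + K)⁻¹ * B) i j)
      (-h' * (C * (h s • M + K)⁻¹ * M * (h s • M + K)⁻¹ * B) i j) s := by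
  have hinv := ((hh.smul_const M).add_const K).matrix_inv hu
  let L : Matrix (Fin n) (Fin n) ℂ →ₗ[ℂ] ℂ :=
    { toFun := fun X => (C * X * B) i j
      map_add' := fun X Y => by simp [Matrix.mul_add, Matrix.add_mul]
      map_smul' := fun c X => by simp }
  refine HasDerivAt.congr_deriv
    ((LinearMap.toContinuousLinearMap L).hasFDerivAt.comp_hasDerivAt s hinv) ?_
  change (C * -((h s • M + K)⁻¹ * h' • M * (h s • M + K)⁻¹) * B) i j = _
  simp [Matrix.mul_assoc]

end

/-- Where `d(s) ≠ 0`, the pencil factors as `φ(s) = d(s) (h(s) M + K)`. -/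
theorem phi_eq_dfun_smul {n : ℕ} (M K : Matrix (Fin n) (Fin n) ℂ) (f g : ℂ → ℂ) {s : ℂ}
    (hd : dfun g s ≠ 0) : phi M K f g s = dfun g s • (hfun f g s • M + K) := by
  rw [smul_add, smul_smul, hfun, mul_div_cancel₀ _ hd]
  simp only [phi, nfun, dfun]
  module

/-- Where `d(s) ≠ 0`, `φ(s)⁻¹ = d(s)⁻¹ (h(s) M + K)⁻¹`. -/
theorem phi_inv_eq_dfun_inv_smul {n : ℕ} (M K : Matrix (Fin n) (Fin n) ℂ) (f g : ℂ → ℂ) {s : ℂ}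
    (hd : dfun g s ≠ 0) :
    (phi M K f g s)⁻¹ = (dfun g s)⁻¹ • (hfun f g s • M + K)⁻¹ := by
  rw [phi_eq_dfun_smul M K f g hd, ← Units.val_mk0 hd, ← Units.smul_def]
  by_cases hu : IsUnit (hfun f g s • M + K)
  · rw [Matrix.inv_smul' _ _ ((Matrix.isUnit_iff_isUnit_det _).1 hu)]
    simp [Units.smul_def]
  · have hcu := (isUnit_smul_iff (Units.mk0 _ hd) (hfun f g s • M + K)).not.2 hu
    rw [Matrix.isUnit_iff_isUnit_det] at hu hcu
    simp only [Matrix.nonsing_inv_apply_not_isUnit _ hu,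
      Matrix.nonsing_inv_apply_not_isUnit _ hcu, smul_zero]

/-- The confluent (Hermite) diagonal-block formula of Theorem 4.1 for the `𝕄` data:
`C_p φ(s₀)⁻¹ M φ(s₀)⁻¹ B = −d(s₀)⁻² · (d·G)'(s₀) · (h'(s₀))⁻¹`,
where `(d·G)'` is the entrywise complex derivative. -/
theorem M_block_confluent {n m p : ℕ} (M K : Matrix (Fin n) (Fin n) ℂ)
    (B : Matrix (Fin n) (Fin m) ℂ) (Cp : Matrix (Fin p) (Fin n) ℂ)
    (f g : ℂ → ℂ) (s₀ : ℂ)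
    (hf : DifferentiableAt ℂ f s₀) (hg : DifferentiableAt ℂ g s₀)
    (hd : dfun g s₀ ≠ 0) (hφ : IsUnit (phi M K f g s₀))
    (hh' : deriv (hfun f g) s₀ ≠ 0) :
    Cp * (phi M K f g s₀)⁻¹ * M * (phi M K f g s₀)⁻¹ * B =
      (-((dfun g s₀) ^ 2)⁻¹ * (deriv (hfun f g) s₀)⁻¹) •
        Matrix.of (fun i j =>
          deriv (fun s => dfun g s * Gtf M K B Cp f g s i j) s₀) := by
  have hu : IsUnit (hfun f g s₀ • M + K) := by
    rw [phi_eq_dfun_smul M K f g hd, ← Units.val_mk0 hd, ← Units.smul_def] at hφ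
    exact (isUnit_smul_iff _ _).1 hφ
  have hh := (differentiableAt_of_deriv_ne_zero hh').hasDerivAt
  have hcont : ContinuousAt (dfun g) s₀ :=
    continuousAt_const.add (continuousAt_id.mul hg.continuousAt)
  ext i j
  have heq : (fun s => dfun g s * Gtf M K B Cp f g s i j) =ᶠ[nhds s₀]
      fun s => (Cp * (hfun f g s • M + K)⁻¹ * B) i j := by
    filter_upwards [hcont.eventually_ne hd] with s hs
    simp [Gtf, phi_inv_eq_dfun_inv_smul M K f g hs, hs]
  rw [Matrix.smul_apply, Matrix.of_apply, heq.deriv_eq,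
    (hasDerivAt_mul_resolvent_mul_apply M K B Cp hh hu i j).deriv,
    phi_inv_eq_dfun_inv_smul M K f g hd]
  simp only [Matrix.mul_smul, Matrix.smul_mul, Matrix.smul_apply, smul_eq_mul]
  field_simp
end

section
/- Let M, K ∈ ℂ^{n×n} be Hermitian positive definite, let α, β ≥ 0 be real numbers such that αM + βK is positive definite, and let W ∈ ℂ^{n×r} satisfy Wᴴ M W = I_r. Set K̃ = Wᴴ K W and D̃ = αI_r + βK̃. Then every λ ∈ ℂ for which there exists a nonzero v ∈ ℂʳ with (λ²I_r + λD̃ + K̃)v = 0 satisfies Re(λ) < 0; that is, the reduced-order second-order system with mass I_r, damping D̃, and stiffness K̃ is asymptotically stable. -/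
open Matrix
open scoped ComplexOrder

/-- A root of a real quadratic polynomial with positive coefficients has negative real part. -/
theorem re_neg_of_quadratic_eq_zero {m d k : ℝ} (hm : 0 < m) (hd : 0 < d) (hk : 0 < k) {l : ℂ}
    (h : l ^ 2 * m + l * d + k = 0) : l.re < 0 := by
  have hre := congrArg Complex.re h
  have him := congrArg Complex.im h
  simp only [pow_two, Complex.add_re, Complex.add_im, Complex.mul_re, Complex.mul_im,
    Complex.ofReal_re, Complex.ofReal_im, Complex.zero_re, Complex.zero_im] at hre him
  by_contra! hl
  have hy : l.im = 0 := by
    have hprod : l.im * (2 * m * l.re + d) = 0 := by linarith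
    have hpos : 0 < 2 * m * l.re + d := by positivity
    exact (mul_eq_zero.mp hprod).resolve_right hpos.ne'
  rw [hy] at hre
  have : 0 ≤ l.re * l.re * m := by positivity
  have : 0 ≤ l.re * d := by positivity
  linarith

/-- The quadratic form of a complex positive definite matrix takes positive real values. -/
theorem Matrix.PosDef.exists_dotProduct_mulVec_eq_ofReal {ι : Type*} [Fintype ι]
    {A : Matrix ι ι ℂ} (hA : A.PosDef) {v : ι → ℂ} (hv : v ≠ 0) :
    ∃ a : ℝ, 0 < a ∧ star v ⬝ᵥ A *ᵥ v = a := by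
  obtain ⟨hre, him⟩ := Complex.pos_iff.mp (hA.dotProduct_mulVec_pos hv)
  exact ⟨_, hre, Complex.ext rfl him.symm⟩

/-- A second-order system with positive definite mass, damping and stiffness matrices is
asymptotically stable. -/
theorem Matrix.PosDef.re_neg_of_quadratic_pencil {ι : Type*} [Fintype ι]
    {M D K : Matrix ι ι ℂ} (hM : M.PosDef) (hD : D.PosDef) (hK : K.PosDef)
    {l : ℂ} {v : ι → ℂ} (hv : v ≠ 0) (h : (l ^ 2 • M + l • D + K) *ᵥ v = 0) : l.re < 0 := by
  obtain ⟨m, hm, hmv⟩ := hM.exists_dotProduct_mulVec_eq_ofReal hv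
  obtain ⟨d, hd, hdv⟩ := hD.exists_dotProduct_mulVec_eq_ofReal hv
  obtain ⟨k, hk, hkv⟩ := hK.exists_dotProduct_mulVec_eq_ofReal hv
  refine re_neg_of_quadratic_eq_zero hm hd hk ?_
  have hform := congrArg (star v ⬝ᵥ ·) h
  simpa only [add_mulVec, smul_mulVec, dotProduct_add, dotProduct_smul, hmv, hdv, hkv,
    smul_eq_mul, dotProduct_zero] using hform

/-- Stability preservation (Theorem 4.2): if `M, K` are Hermitian positive definite,
`α, β ≥ 0` are such that the Rayleigh damping `αM + βK` is positive definite, and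
`Wᴴ M W = I_r`, then the reduced second-order system with mass `I_r`, damping
`D̃ = αI_r + βK̃`, and stiffness `K̃ = Wᴴ K W` is asymptotically stable: every
eigenvalue `λ` of the pencil `λ²I_r + λD̃ + K̃` satisfies `Re λ < 0`. -/
theorem reduced_system_stable {n r : ℕ}
    (M K : Matrix (Fin n) (Fin n) ℂ) (hM : M.PosDef) (hK : K.PosDef)
    (α β : ℝ) (hα : 0 ≤ α) (hβ : 0 ≤ β)
    (hD : ((α : ℂ) • M + (β : ℂ) • K).PosDef)
    (W : Matrix (Fin n) (Fin r) ℂ) (hW : Wᴴ * M * W = 1) :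
    ∀ (l : ℂ) (v : Fin r → ℂ), v ≠ 0 →
      (l ^ 2 • (1 : Matrix (Fin r) (Fin r) ℂ) +
          l • ((α : ℂ) • (1 : Matrix (Fin r) (Fin r) ℂ) + (β : ℂ) • (Wᴴ * K * W)) +
          Wᴴ * K * W).mulVec v = 0 →
      l.re < 0 := by
  intro l v hv h
  have hinj : Function.Injective W.mulVec :=
    Function.LeftInverse.injective (g := (Wᴴ * M).mulVec) fun x => by
      rw [mulVec_mulVec, hW, one_mulVec]
  have hDr := hD.conjTranspose_mul_mul_same hinj
  rw [Matrix.mul_add, Matrix.add_mul, Matrix.mul_smul, Matrix.smul_mul, Matrix.mul_smul,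
    Matrix.smul_mul, hW] at hDr
  exact PosDef.one.re_neg_of_quadratic_pencil hDr (hK.conjTranspose_mul_mul_same hinj) hv h
end

section
/- Let M, K ∈ ℂ^{n×n}, B ∈ ℂ^{n×m}, C_p, C_v ∈ ℂ^{p×n}, and let P_p, Q_v ∈ ℂ^{n×n} be Hermitian positive definite with Cholesky-type factorizations P_p = R_p R_pᴴ and Q_v = L_v L_vᴴ where R_p, L_v ∈ ℂ^{n×n}. Let Ř_p ∈ ℂ^{n×mJ} and Ľ_v ∈ ℂ^{n×pK} be matrices such that, for some δ ∈ (0,1), ‖P_p − Ř_p Ř_pᴴ‖_F ≤ (δ/(1+δ))·σ_min(P_p) and ‖Q_v − Ľ_v Ľ_vᴴ‖_F ≤ (δ/(1+δ))·σ_min(Q_v), where σ_min denotes the smallest eigenvalue of the Hermitian positive definite matrix. Then there exist partial isometries Ψ_v ∈ ℂ^{pK×n} and Ψ_p ∈ ℂ^{mJ×n} such that ‖Ľ_vᴴ M Ř_p − Ψ_v (L_vᴴ M R_p) Ψ_pᴴ‖_F ≤ 2δ‖L_v‖₂‖M‖₂‖R_p‖₂, ‖Ľ_vᴴ K Ř_p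 − Ψ_v (L_vᴴ K R_p) Ψ_pᴴ‖_F ≤ 2δ‖L_v‖₂‖K‖₂‖R_p‖₂, ‖Ľ_vᴴ B − Ψ_v (L_vᴴ B)‖_F ≤ 2δ‖L_v‖₂‖B‖₂, ‖C_p Ř_p − (C_p R_p) Ψ_pᴴ‖_F ≤ 2δ‖C_p‖₂‖R_p‖₂, and ‖C_v Ř_p − (C_v R_p) Ψ_pᴴ‖_F ≤ 2δ‖C_v‖₂‖R_p‖₂. -/
open Matrix
open scoped ComplexOrder

/-- Frobenius norm of a complex matrix. -/
noncomputable def frobNorm {a b : Type*} [Fintype a] [Fintype b]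
    (A : Matrix a b ℂ) : ℝ :=
  Real.sqrt (∑ i, ∑ j, ‖A i j‖ ^ 2)

/-- Spectral norm (largest singular value) of a complex matrix, realized as the
operator norm of the induced map between Euclidean spaces. -/
noncomputable def specNorm {a b : Type*} [Fintype a] [Fintype b] [DecidableEq b]
    (A : Matrix a b ℂ) : ℝ :=
  ‖LinearMap.toContinuousLinearMap (Matrix.toEuclideanLin A)‖

/-- Smallest eigenvalue of a Hermitian positive definite matrix. -/
noncomputable def sigmaMin {n : ℕ} {A : Matrix (Fin n) (Fin n) ℂ} (hA : A.PosDef) : ℝ :=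
  ⨅ i, hA.1.eigenvalues i

section FrobeniusNorm

variable {a b c : Type*} [Fintype a] [Fintype b] [Fintype c]

attribute [local instance] Matrix.frobeniusNormedAddCommGroup

lemma frobNorm_eq_norm (A : Matrix a b ℂ) : frobNorm A = ‖A‖ := by
  rw [frobNorm, Matrix.frobenius_norm_def, Real.sqrt_eq_rpow]
  norm_cast

lemma frobNorm_nonneg (A : Matrix a b ℂ) : 0 ≤ frobNorm A := Real.sqrt_nonneg _

lemma frobNorm_add_le (A B : Matrix a b ℂ) : frobNorm (A + B) ≤ frobNorm A + frobNorm B := by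
  simpa only [frobNorm_eq_norm] using norm_add_le A B

lemma frobNorm_sub_rev (A B : Matrix a b ℂ) : frobNorm (A - B) = frobNorm (B - A) := by
  simpa only [frobNorm_eq_norm] using norm_sub_rev A B

lemma frobNorm_conjTranspose (A : Matrix a b ℂ) : frobNorm Aᴴ = frobNorm A := by
  simpa only [frobNorm_eq_norm] using Matrix.frobenius_norm_conjTranspose A

lemma frobNorm_mul_le (A : Matrix a b ℂ) (B : Matrix b c ℂ) :
    frobNorm (A * B) ≤ frobNorm A * frobNorm B := by
  simpa only [frobNorm_eq_norm] using Matrix.frobenius_norm_mul A B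

lemma frobNorm_replicateCol (v : a → ℂ) :
    frobNorm (replicateCol Unit v) = ‖WithLp.toLp 2 v‖ := by
  rw [frobNorm_eq_norm, Matrix.frobenius_norm_replicateCol]

lemma frobNorm_sq (A : Matrix a b ℂ) : frobNorm A ^ 2 = (Aᴴ * A).trace.re := by
  rw [frobNorm, Real.sq_sqrt (by positivity), Finset.sum_comm]
  simp [Matrix.trace, Matrix.mul_apply, ← Complex.normSq_eq_norm_sq, Complex.normSq_apply]

lemma frobNorm_isometry_mul [DecidableEq b] {Ψ : Matrix a b ℂ} (hΨ : Ψᴴ * Ψ = 1)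
    (A : Matrix b c ℂ) : frobNorm (Ψ * A) = frobNorm A := by
  rw [← sq_eq_sq₀ (frobNorm_nonneg _) (frobNorm_nonneg _), frobNorm_sq, frobNorm_sq,
    conjTranspose_mul, Matrix.mul_assoc, ← Matrix.mul_assoc Ψᴴ, hΨ, Matrix.one_mul]

lemma frobNorm_mul_isometry_conjTranspose [DecidableEq b] {Ψ : Matrix a b ℂ} (hΨ : Ψᴴ * Ψ = 1)
    (A : Matrix c b ℂ) : frobNorm (A * Ψᴴ) = frobNorm A := by
  rw [← frobNorm_conjTranspose, conjTranspose_mul, conjTranspose_conjTranspose,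
    frobNorm_isometry_mul hΨ, frobNorm_conjTranspose]

lemma isUnit_of_frobNorm_one_sub_lt_one [DecidableEq a] {A : Matrix a a ℂ}
    (hA : frobNorm (1 - A) < 1) : IsUnit A := by
  let := Matrix.frobeniusNormedRing (m := a) (α := ℂ)
  let := Matrix.frobeniusNormedAlgebra (m := a) (R := ℂ) (α := ℂ)
  have : CompleteSpace (Matrix a a ℂ) := FiniteDimensional.complete ℂ _
  have h : ‖1 - A‖ < 1 := by rwa [frobNorm_eq_norm] at hA
  simpa using isUnit_one_sub_of_norm_lt_one h

end FrobeniusNorm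

section SpectralNorm

variable {a b c : Type*} [Fintype a] [Fintype b] [Fintype c] [DecidableEq b]

lemma specNorm_nonneg (A : Matrix a b ℂ) : 0 ≤ specNorm A := norm_nonneg _

open scoped Matrix.Norms.L2Operator in
lemma specNorm_eq_norm (A : Matrix a b ℂ) : specNorm A = ‖A‖ := rfl

open scoped Matrix.Norms.L2Operator in
lemma specNorm_conjTranspose [DecidableEq a] (A : Matrix a b ℂ) : specNorm Aᴴ = specNorm A := by
  simpa only [specNorm_eq_norm] using Matrix.l2_opNorm_conjTranspose A

open scoped Matrix.Norms.L2Operator in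
lemma specNorm_mul_le [DecidableEq c] (A : Matrix a b ℂ) (B : Matrix b c ℂ) :
    specNorm (A * B) ≤ specNorm A * specNorm B := by
  simpa only [specNorm_eq_norm] using Matrix.l2_opNorm_mul A B

lemma specNorm_mulVec_le (A : Matrix a b ℂ) (x : b → ℂ) :
    ‖WithLp.toLp 2 (A *ᵥ x)‖ ≤ specNorm A * ‖WithLp.toLp 2 x‖ :=
  Matrix.l2_opNorm_mulVec A (WithLp.toLp 2 x)

lemma frobNorm_mul_le_specNorm_mul (A : Matrix a b ℂ) (B : Matrix b c ℂ) :
    frobNorm (A * B) ≤ specNorm A * frobNorm B := by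
  have key (j : c) : ∑ i, ‖(A * B) i j‖ ^ 2 ≤ specNorm A ^ 2 * ∑ i, ‖B i j‖ ^ 2 := by
    have h := pow_le_pow_left₀ (norm_nonneg _) (specNorm_mulVec_le A (fun k => B k j)) 2
    rw [mul_pow, EuclideanSpace.norm_sq_eq, EuclideanSpace.norm_sq_eq] at h
    exact h
  rw [← sq_le_sq₀ (frobNorm_nonneg _) (mul_nonneg (specNorm_nonneg _) (frobNorm_nonneg _)),
    mul_pow, frobNorm, frobNorm, Real.sq_sqrt (by positivity), Real.sq_sqrt (by positivity),
    Finset.sum_comm, Finset.sum_comm (f := fun i j => ‖B i j‖ ^ 2), Finset.mul_sum]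
  exact Finset.sum_le_sum fun j _ => key j

lemma frobNorm_mul_le_mul_specNorm [DecidableEq c] (A : Matrix a b ℂ) (B : Matrix b c ℂ) :
    frobNorm (A * B) ≤ frobNorm A * specNorm B := by
  rw [← frobNorm_conjTranspose, conjTranspose_mul, mul_comm (frobNorm A),
    ← specNorm_conjTranspose, ← frobNorm_conjTranspose A]
  exact frobNorm_mul_le_specNorm_mul _ _

lemma specNorm_le_of_frobNorm_mul_le {A : Matrix a b ℂ} {C : ℝ} (hC : 0 ≤ C)
    (h : ∀ Z : Matrix b Unit ℂ, frobNorm (A * Z) ≤ C * frobNorm Z) : specNorm A ≤ C := by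
  refine ContinuousLinearMap.opNorm_le_bound _ hC fun x => ?_
  have hx := h (replicateCol Unit x.ofLp)
  rw [← replicateCol_mulVec, frobNorm_replicateCol, frobNorm_replicateCol] at hx
  exact hx

end SpectralNorm

lemma sigmaMin_nonneg {n : ℕ} {A : Matrix (Fin n) (Fin n) ℂ} (hA : A.PosDef) :
    0 ≤ sigmaMin hA :=
  Real.iInf_nonneg fun i => (hA.eigenvalues_pos i).le

lemma posSemidef_sub_sigmaMin_smul_one {n : ℕ} {A : Matrix (Fin n) (Fin n) ℂ} (hA : A.PosDef) :
    (A - (sigmaMin hA : ℂ) • (1 : Matrix (Fin n) (Fin n) ℂ)).PosSemidef := by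
  let U : Matrix (Fin n) (Fin n) ℂ := hA.1.eigenvectorUnitary.val
  have hUU : U * Uᴴ = 1 := Unitary.coe_mul_star_self hA.1.eigenvectorUnitary
  have hd : (diagonal fun i => ((hA.1.eigenvalues i - sigmaMin hA : ℝ) : ℂ)).PosSemidef :=
    PosSemidef.diagonal fun i => by
      have : sigmaMin hA ≤ hA.1.eigenvalues i := ciInf_le (Set.finite_range _).bddBelow i
      simpa using this
  have h := hd.mul_mul_conjTranspose_same U
  convert h using 1
  have hs : (diagonal fun i => ((hA.1.eigenvalues i - sigmaMin hA : ℝ) : ℂ)) =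
      diagonal (RCLike.ofReal ∘ hA.1.eigenvalues) -
        (sigmaMin hA : ℂ) • (1 : Matrix (Fin n) (Fin n) ℂ) := by
    ext i j
    by_cases hij : i = j <;> simp [hij]
  rw [hs, Matrix.mul_sub, Matrix.sub_mul, Matrix.mul_smul, Matrix.smul_mul, Matrix.mul_one, hUU]
  congr 1
  conv_lhs => rw [hA.1.spectral_theorem, Unitary.conjStarAlgAut_apply]
  rfl

lemma sigmaMin_mul_frobNorm_sq_le {n : ℕ} {c : Type*} [Fintype c]
    {R : Matrix (Fin n) (Fin n) ℂ} (hA : (R * Rᴴ).PosDef) (Y : Matrix (Fin n) c ℂ) :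
    sigmaMin hA * frobNorm Y ^ 2 ≤ frobNorm (Rᴴ * Y) ^ 2 := by
  have h := (posSemidef_sub_sigmaMin_smul_one hA).conjTranspose_mul_mul_same Y |>.trace_nonneg
  have h' := (Complex.le_def.1 h).1
  rw [Matrix.mul_sub, Matrix.sub_mul, Matrix.mul_smul, Matrix.smul_mul, Matrix.mul_one,
    Matrix.trace_sub, Matrix.trace_smul, smul_eq_mul, Complex.sub_re, Complex.re_ofReal_mul,
    Complex.zero_re] at h'
  rw [frobNorm_sq, frobNorm_sq, conjTranspose_mul, conjTranspose_conjTranspose]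
  simp only [Matrix.mul_assoc] at h' ⊢
  linarith

lemma sigmaMin_mul_specNorm_inv_sq_le {n : ℕ} {R : Matrix (Fin n) (Fin n) ℂ}
    (hA : (R * Rᴴ).PosDef) (hR : IsUnit R.det) : sigmaMin hA * specNorm R⁻¹ ^ 2 ≤ 1 := by
  rcases (sigmaMin_nonneg hA).eq_or_lt with h0 | h0
  · simp [← h0]
  have hs : specNorm (Rᴴ)⁻¹ ≤ (√(sigmaMin hA))⁻¹ := by
    refine specNorm_le_of_frobNorm_mul_le (by positivity) fun Z => ?_
    have h := sigmaMin_mul_frobNorm_sq_le hA ((Rᴴ)⁻¹ * Z)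
    have hR' : IsUnit (Rᴴ).det := by rw [det_conjTranspose]; exact hR.star
    rw [mul_nonsing_inv_cancel_left _ _ hR'] at h
    have hσ := Real.sqrt_pos.2 h0
    rw [inv_mul_eq_div, le_div_iff₀ hσ,
      ← sq_le_sq₀ (mul_nonneg (frobNorm_nonneg _) hσ.le) (frobNorm_nonneg _),
      mul_pow, Real.sq_sqrt h0.le]
    linarith
  rw [← conjTranspose_nonsing_inv, specNorm_conjTranspose] at hs
  calc sigmaMin hA * specNorm R⁻¹ ^ 2 ≤ sigmaMin hA * (√(sigmaMin hA))⁻¹ ^ 2 := by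
        gcongr
        exact specNorm_nonneg _
    _ = 1 := by rw [inv_pow, Real.sq_sqrt h0.le, mul_inv_cancel₀ h0.ne']

lemma frobNorm_sub_one_le {n : ℕ} {S : Matrix (Fin n) (Fin n) ℂ} (hS : S.PosSemidef) :
    frobNorm (S - 1) ≤ frobNorm (S * S - 1) := by
  have hfac : S * S - 1 = (S + 1) * (S - 1) := by noncomm_ring
  have hH : (S + 1)ᴴ = S + 1 := by rw [conjTranspose_add, hS.1.eq, conjTranspose_one]
  have hpos : (S * S + S + S).PosSemidef := by
    have h := posSemidef_conjTranspose_mul_self S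
    rw [hS.1.eq] at h
    exact (h.add hS).add hS
  have h := (hpos.conjTranspose_mul_mul_same (S - 1)).trace_nonneg
  have h' := (Complex.le_def.1 h).1
  have hexp : (S - 1)ᴴ * (S + 1) * ((S + 1) * (S - 1)) =
      (S - 1)ᴴ * (S * S + S + S) * (S - 1) + (S - 1)ᴴ * (S - 1) := by noncomm_ring
  rw [← sq_le_sq₀ (frobNorm_nonneg _) (frobNorm_nonneg _), hfac, frobNorm_sq, frobNorm_sq,
    conjTranspose_mul, hH, hexp, Matrix.trace_add, Complex.add_re]
  simpa using h'

open scoped MatrixOrder in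
/-- A factor `Rq` of a good approximation of `R * Rᴴ` is `R`, up to a small perturbation of the
identity and an isometry. -/
lemma exists_isometry_approx_factor {n k : ℕ} {P R : Matrix (Fin n) (Fin n) ℂ} (hP : P.PosDef)
    (hR : P = R * Rᴴ) (Rq : Matrix (Fin n) (Fin k) ℂ) {η : ℝ} (hη : 0 ≤ η) (hη1 : η < 1)
    (h : frobNorm (P - Rq * Rqᴴ) ≤ η * sigmaMin hP) :
    ∃ (Ψ : Matrix (Fin k) (Fin n) ℂ) (S : Matrix (Fin n) (Fin n) ℂ),
      Ψᴴ * Ψ = 1 ∧ Rq = R * S * Ψᴴ ∧ frobNorm (S - 1) ≤ η := by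
  subst hR
  have hRdet : IsUnit R.det :=
    isUnit_of_mul_isUnit_left (by
      rw [← det_mul]
      exact (isUnit_iff_isUnit_det _).1 hP.isUnit)
  have hRdet' : IsUnit (Rᴴ).det := by rw [det_conjTranspose]; exact hRdet.star
  set X := R⁻¹ * Rq with hX
  have hRX : R * X = Rq := mul_nonsing_inv_cancel_left _ _ hRdet
  have hXX : frobNorm (1 - X * Xᴴ) ≤ η := by
    have hfac : 1 - X * Xᴴ = R⁻¹ * (R * Rᴴ - Rq * Rqᴴ) * (R⁻¹)ᴴ := by
      rw [Matrix.mul_sub, Matrix.sub_mul, nonsing_inv_mul_cancel_left _ _ hRdet,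
        conjTranspose_nonsing_inv, mul_nonsing_inv _ hRdet', hX, conjTranspose_mul,
        conjTranspose_nonsing_inv]
      simp only [Matrix.mul_assoc]
    rw [hfac]
    calc frobNorm (R⁻¹ * (R * Rᴴ - Rq * Rqᴴ) * (R⁻¹)ᴴ)
        ≤ specNorm R⁻¹ * frobNorm (R * Rᴴ - Rq * Rqᴴ) * specNorm (R⁻¹)ᴴ :=
          (frobNorm_mul_le_mul_specNorm _ _).trans (mul_le_mul_of_nonneg_right
            (frobNorm_mul_le_specNorm_mul _ _) (specNorm_nonneg _))
      _ ≤ specNorm R⁻¹ * (η * sigmaMin hP) * specNorm (R⁻¹)ᴴ := by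
          gcongr <;> exact specNorm_nonneg _
      _ = η * (sigmaMin hP * specNorm R⁻¹ ^ 2) := by rw [specNorm_conjTranspose]; ring
      _ ≤ η := mul_le_of_le_one_right hη (sigmaMin_mul_specNorm_inv_sq_le hP hRdet)
  have hpsd : (X * Xᴴ).PosSemidef := posSemidef_self_mul_conjTranspose X
  set S := CFC.sqrt (X * Xᴴ)
  have hSS : S * S = X * Xᴴ := CFC.sqrt_mul_sqrt_self _ hpsd.nonneg
  have hSpsd : S.PosSemidef := (CFC.sqrt_nonneg (X * Xᴴ)).posSemidef
  have hSdet : IsUnit S.det := by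
    have hu := (isUnit_iff_isUnit_det _).1 (isUnit_of_frobNorm_one_sub_lt_one (hXX.trans_lt hη1))
    rw [← hSS, det_mul] at hu
    exact isUnit_of_mul_isUnit_left hu
  have hSinv : (S⁻¹)ᴴ = S⁻¹ := by rw [conjTranspose_nonsing_inv, hSpsd.1.eq]
  refine ⟨(S⁻¹ * X)ᴴ, S, ?_, ?_, ?_⟩
  · rw [conjTranspose_conjTranspose, conjTranspose_mul, hSinv, Matrix.mul_assoc,
      ← Matrix.mul_assoc X, ← hSS, mul_nonsing_inv_cancel_right _ _ hSdet,
      nonsing_inv_mul _ hSdet]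
  · rw [conjTranspose_conjTranspose, Matrix.mul_assoc, mul_nonsing_inv_cancel_left _ _ hSdet, hRX]
  · refine (frobNorm_sub_one_le hSpsd).trans ?_
    rwa [hSS, frobNorm_sub_rev]

lemma mul_conjTranspose_mul_self_of_isometry {k n : ℕ} {Ψ : Matrix (Fin k) (Fin n) ℂ}
    (hΨ : Ψᴴ * Ψ = 1) : Ψ * Ψᴴ * Ψ = Ψ := by
  rw [Matrix.mul_assoc, hΨ, Matrix.mul_one]

lemma frobNorm_mul_factor_sub_le {n k q : ℕ} {R S : Matrix (Fin n) (Fin n) ℂ}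
    {Ψ : Matrix (Fin k) (Fin n) ℂ} (hΨ : Ψᴴ * Ψ = 1) {η : ℝ} (hS : frobNorm (S - 1) ≤ η)
    (C : Matrix (Fin q) (Fin n) ℂ) :
    frobNorm (C * (R * S * Ψᴴ) - C * R * Ψᴴ) ≤ η * specNorm C * specNorm R := by
  have hfac : C * (R * S * Ψᴴ) - C * R * Ψᴴ = C * R * (S - 1) * Ψᴴ := by
    rw [Matrix.mul_sub, Matrix.sub_mul]
    simp only [Matrix.mul_assoc, Matrix.one_mul]
  rw [hfac, frobNorm_mul_isometry_conjTranspose hΨ]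
  calc frobNorm (C * R * (S - 1)) ≤ specNorm (C * R) * frobNorm (S - 1) :=
        frobNorm_mul_le_specNorm_mul _ _
    _ ≤ specNorm C * specNorm R * η :=
        mul_le_mul (specNorm_mul_le _ _) hS (frobNorm_nonneg _)
          (mul_nonneg (specNorm_nonneg _) (specNorm_nonneg _))
    _ = η * specNorm C * specNorm R := by ring

lemma frobNorm_factor_conjTranspose_mul_sub_le {n k q : ℕ} {L T : Matrix (Fin n) (Fin n) ℂ}
    {Ψ : Matrix (Fin k) (Fin n) ℂ} (hΨ : Ψᴴ * Ψ = 1) {η : ℝ} (hT : frobNorm (T - 1) ≤ η)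
    (B : Matrix (Fin n) (Fin q) ℂ) :
    frobNorm ((L * T * Ψᴴ)ᴴ * B - Ψ * (Lᴴ * B)) ≤ η * specNorm L * specNorm B := by
  have h := frobNorm_mul_factor_sub_le (R := L) hΨ hT Bᴴ
  rw [← frobNorm_conjTranspose, specNorm_conjTranspose] at h
  simp only [conjTranspose_sub, conjTranspose_mul, conjTranspose_conjTranspose,
    Matrix.mul_assoc] at h ⊢
  linarith

lemma frobNorm_factor_conjTranspose_mul_mul_factor_sub_le {n k l : ℕ}
    {L T R S : Matrix (Fin n) (Fin n) ℂ} {Φ : Matrix (Fin k) (Fin n) ℂ}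
    {Ψ : Matrix (Fin l) (Fin n) ℂ} (hΦ : Φᴴ * Φ = 1) (hΨ : Ψᴴ * Ψ = 1) {η : ℝ} (hη : 0 ≤ η)
    (hT : frobNorm (T - 1) ≤ η) (hS : frobNorm (S - 1) ≤ η) (M : Matrix (Fin n) (Fin n) ℂ) :
    frobNorm ((L * T * Φᴴ)ᴴ * M * (R * S * Ψᴴ) - Φ * (Lᴴ * M * R) * Ψᴴ) ≤
      η * (2 + η) * specNorm L * specNorm M * specNorm R := by
  set A := Lᴴ * M * R with hA
  have hT' : frobNorm (Tᴴ - 1) ≤ η := by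
    rw [← frobNorm_conjTranspose]
    simpa using hT
  have hfac : (L * T * Φᴴ)ᴴ * M * (R * S * Ψᴴ) - Φ * A * Ψᴴ =
      Φ * ((Tᴴ - 1) * (A * (S - 1)) + (Tᴴ - 1) * A + A * (S - 1)) * Ψᴴ := by
    have h1 : (Tᴴ - 1) * (A * (S - 1)) + (Tᴴ - 1) * A + A * (S - 1) = Tᴴ * A * S - A := by
      noncomm_ring
    rw [h1, Matrix.mul_sub, Matrix.sub_mul, hA]
    simp only [conjTranspose_mul, conjTranspose_conjTranspose, Matrix.mul_assoc]
  have hAle : specNorm A ≤ specNorm L * specNorm M * specNorm R := by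
    rw [hA, ← specNorm_conjTranspose L]
    exact (specNorm_mul_le _ _).trans
      (mul_le_mul_of_nonneg_right (specNorm_mul_le _ _) (specNorm_nonneg _))
  have h3 : frobNorm (A * (S - 1)) ≤ specNorm A * η :=
    (frobNorm_mul_le_specNorm_mul _ _).trans (mul_le_mul_of_nonneg_left hS (specNorm_nonneg _))
  have h2 : frobNorm ((Tᴴ - 1) * A) ≤ η * specNorm A :=
    (frobNorm_mul_le_mul_specNorm _ _).trans (mul_le_mul_of_nonneg_right hT' (specNorm_nonneg _))
  have h1 : frobNorm ((Tᴴ - 1) * (A * (S - 1))) ≤ η * (specNorm A * η) :=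
    (frobNorm_mul_le _ _).trans (mul_le_mul hT' h3 (frobNorm_nonneg _) hη)
  rw [hfac, frobNorm_mul_isometry_conjTranspose hΨ, frobNorm_isometry_mul hΦ]
  calc frobNorm ((Tᴴ - 1) * (A * (S - 1)) + (Tᴴ - 1) * A + A * (S - 1))
      ≤ frobNorm ((Tᴴ - 1) * (A * (S - 1))) + frobNorm ((Tᴴ - 1) * A) + frobNorm (A * (S - 1)) :=
        (frobNorm_add_le _ _).trans (add_le_add_left (frobNorm_add_le _ _) _)
    _ ≤ η * (2 + η) * specNorm A := by linarith
    _ ≤ η * (2 + η) * (specNorm L * specNorm M * specNorm R) :=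
        mul_le_mul_of_nonneg_left hAle (by positivity)
    _ = η * (2 + η) * specNorm L * specNorm M * specNorm R := by ring

/-- Error control (Theorem 4.3): if the quadrature-based factors `Ř_p, Ľ_v`
approximate the Gramians `P_p = R_p R_pᴴ` and `Q_v = L_v L_vᴴ` well enough,
then there exist partial isometries aligning the data matrices of `soQuadpvBT`
with their intrusive counterparts, with explicit error bounds. -/
theorem quadBT_error_bounds {n m p mJ pK : ℕ}
    (M K : Matrix (Fin n) (Fin n) ℂ) (B : Matrix (Fin n) (Fin m) ℂ)
    (Cp Cv : Matrix (Fin p) (Fin n) ℂ)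
    (Pp Qv Rp Lv : Matrix (Fin n) (Fin n) ℂ)
    (hPp : Pp.PosDef) (hQv : Qv.PosDef)
    (hRp : Pp = Rp * Rpᴴ) (hLv : Qv = Lv * Lvᴴ)
    (Rq : Matrix (Fin n) (Fin mJ) ℂ) (Lq : Matrix (Fin n) (Fin pK) ℂ)
    (δ : ℝ) (hδ : δ ∈ Set.Ioo (0 : ℝ) 1)
    (hP : frobNorm (Pp - Rq * Rqᴴ) ≤ δ / (1 + δ) * sigmaMin hPp)
    (hQ : frobNorm (Qv - Lq * Lqᴴ) ≤ δ / (1 + δ) * sigmaMin hQv) :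
    ∃ (Ψv : Matrix (Fin pK) (Fin n) ℂ) (Ψp : Matrix (Fin mJ) (Fin n) ℂ),
      Ψv * Ψvᴴ * Ψv = Ψv ∧ Ψp * Ψpᴴ * Ψp = Ψp ∧
      frobNorm (Lqᴴ * M * Rq - Ψv * (Lvᴴ * M * Rp) * Ψpᴴ) ≤
        2 * δ * specNorm Lv * specNorm M * specNorm Rp ∧
      frobNorm (Lqᴴ * K * Rq - Ψv * (Lvᴴ * K * Rp) * Ψpᴴ) ≤
        2 * δ * specNorm Lv * specNorm K * specNorm Rp ∧
      frobNorm (Lqᴴ * B - Ψv * (Lvᴴ * B)) ≤ 2 * δ * specNorm Lv * specNorm B ∧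
      frobNorm (Cp * Rq - Cp * Rp * Ψpᴴ) ≤ 2 * δ * specNorm Cp * specNorm Rp ∧
      frobNorm (Cv * Rq - Cv * Rp * Ψpᴴ) ≤ 2 * δ * specNorm Cv * specNorm Rp := by
  obtain ⟨hδ0, hδ1⟩ := hδ
  set η := δ / (1 + δ) with hη
  have hη0 : 0 ≤ η := by positivity
  have hη1 : η < 1 := by rw [hη, div_lt_one (by linarith)]; linarith
  have hηle : η ≤ 2 * δ := by
    rw [hη, div_le_iff₀ (by linarith)]
    nlinarith
  have hηsq : η * (2 + η) ≤ 2 * δ := by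
    have h : η * (1 + δ) = δ := by rw [hη]; field_simp
    have hle : η ≤ δ := by nlinarith
    nlinarith [mul_nonneg hη0 (sub_nonneg.2 hle)]
  obtain ⟨Ψp, S, hΨp, rfl, hS⟩ := exists_isometry_approx_factor hPp hRp Rq hη0 hη1 hP
  obtain ⟨Ψv, T, hΨv, rfl, hT⟩ := exists_isometry_approx_factor hQv hLv Lq hη0 hη1 hQ
  have weaken {x ε u v : ℝ} (hx : x ≤ ε * u * v) (hε : ε ≤ 2 * δ) (hu : 0 ≤ u) (hv : 0 ≤ v) :
      x ≤ 2 * δ * u * v := hx.trans (by gcongr)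
  have weaken₃ {x ε u v w : ℝ} (hx : x ≤ ε * u * v * w) (hε : ε ≤ 2 * δ) (hu : 0 ≤ u)
      (hv : 0 ≤ v) (hw : 0 ≤ w) : x ≤ 2 * δ * u * v * w := hx.trans (by gcongr)
  exact ⟨Ψv, Ψp, mul_conjTranspose_mul_self_of_isometry hΨv,
    mul_conjTranspose_mul_self_of_isometry hΨp,
    weaken₃ (frobNorm_factor_conjTranspose_mul_mul_factor_sub_le hΨv hΨp hη0 hT hS M) hηsq
      (specNorm_nonneg _) (specNorm_nonneg _) (specNorm_nonneg _),
    weaken₃ (frobNorm_factor_conjTranspose_mul_mul_factor_sub_le hΨv hΨp hη0 hT hS K) hηsq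
      (specNorm_nonneg _) (specNorm_nonneg _) (specNorm_nonneg _),
    weaken (frobNorm_factor_conjTranspose_mul_sub_le hΨv hT B) hηle
      (specNorm_nonneg _) (specNorm_nonneg _),
    weaken (frobNorm_mul_factor_sub_le hΨp hS Cp) hηle (specNorm_nonneg _) (specNorm_nonneg _),
    weaken (frobNorm_mul_factor_sub_le hΨp hS Cv) hηle (specNorm_nonneg _) (specNorm_nonneg _)⟩
end

section
/- Let M̃, K̃ ∈ ℂ^{r×r}, B̃ ∈ ℂ^{r×m}, C̃_p, C̃_v ∈ ℂ^{p×r}, let g_k ∈ ℂ^{p×m}, and let s_k ∈ ℂ. Define φ_R(s, α, β) = (s² + sα)M̃ + (1 + sβ)K̃ and 𝒞(s) = C̃_p + sC̃_v. Fix (α, β) ∈ ℝ² such that φ_R(s_k, α, β) is invertible, and define J(a) = ‖g_k − 𝒞(s_k) φ_R(s_k, a, β)⁻¹ B̃‖_F² for a in a neighborhood of α on which φ_R(s_k, a, β) is invertible. Then J is differentiable at α with derivative J'(α) = 2·Re( s_k · trace( M̃ φ_R(s_k, α, β)⁻¹ B̃ (g_k − 𝒞(s_k) φ_R(s_k, α,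 β)⁻¹ B̃)ᴴ 𝒞(s_k) φ_R(s_k, α, β)⁻¹ ) ). -/
open Matrix

/-- Rayleigh-damped reduced resolvent `φ_R(s, α, β) = (s² + sα)M̃ + (1 + sβ)K̃`. -/
noncomputable def phiR {r : ℕ} (Mt Kt : Matrix (Fin r) (Fin r) ℂ) (s : ℂ) (a b : ℝ) :
    Matrix (Fin r) (Fin r) ℂ :=
  (s ^ 2 + s * (a : ℂ)) • Mt + (1 + s * (b : ℂ)) • Kt

/-- Output map `𝒞(s) = C̃_p + s C̃_v`. -/
noncomputable def Cout {r p : ℕ} (Cpt Cvt : Matrix (Fin p) (Fin r) ℂ) (s : ℂ) :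
    Matrix (Fin p) (Fin r) ℂ :=
  Cpt + s • Cvt

/-- Squared Frobenius norm of a complex matrix. -/
noncomputable def frobNormSq {a b : Type*} [Fintype a] [Fintype b]
    (A : Matrix a b ℂ) : ℝ :=
  ∑ i, ∑ j, ‖A i j‖ ^ 2

open scoped Matrix.Norms.Operator in
/-- The inverse of an entrywise differentiable matrix path is entrywise differentiable, with
derivative `-A⁻¹ A' A⁻¹`. -/
theorem hasDerivAt_matrix_inv_apply {n : Type*} [Fintype n] [DecidableEq n]
    {A : ℝ → Matrix n n ℂ} {A' : Matrix n n ℂ} {t : ℝ}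
    (hA : ∀ i j, HasDerivAt (fun u => A u i j) (A' i j) t) (ht : IsUnit (A t)) (i j : n) :
    HasDerivAt (fun u => (A u)⁻¹ i j) ((-((A t)⁻¹ * A' * (A t)⁻¹)) i j) t := by
  have hA' : HasDerivAt A A' t := by
    have h : HasDerivAt (fun u => ∑ k, ∑ l, A u k l • Matrix.single k l (1 : ℂ))
        (∑ k, ∑ l, A' k l • Matrix.single k l (1 : ℂ)) t :=
      HasDerivAt.fun_sum fun k _ => HasDerivAt.fun_sum fun l _ => (hA k l).smul_const _
    have e (B : Matrix n n ℂ) : ∑ k, ∑ l, B k l • Matrix.single k l (1 : ℂ) = B := by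
      conv_rhs => rw [Matrix.matrix_eq_sum_single B]
      simp
    simpa only [e] using h
  obtain ⟨u, hu⟩ := ht
  have hR := hasFDerivAt_ringInverse (𝕜 := ℝ) u
  rw [hu] at hR
  have hinv := hR.comp_hasDerivAt t hA'
  have hcoe : (↑u⁻¹ : Matrix n n ℂ) = (A t)⁻¹ := by rw [Matrix.coe_units_inv, hu]
  have he := ((Matrix.entryLinearMap ℝ ℂ i j).toContinuousLinearMap).hasFDerivAt.comp_hasDerivAt
    t hinv
  have hval : HasDerivAt (fun u => Ring.inverse (A u) i j)
      ((-((A t)⁻¹ * A' * (A t)⁻¹)) i j) t := by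
    simpa [Function.comp_def, hcoe] using! he
  simpa only [Matrix.nonsing_inv_eq_ringInverse] using hval

/-- The squared Frobenius norm of a matrix path `E` has derivative `2 Re tr (E' Eᴴ)`. -/
theorem hasDerivAt_frobNormSq {m n : Type*} [Fintype m] [Fintype n]
    {E : ℝ → Matrix m n ℂ} {E' : Matrix m n ℂ} {t : ℝ}
    (hE : ∀ i j, HasDerivAt (fun u => E u i j) (E' i j) t) :
    HasDerivAt (fun u => frobNormSq (E u)) (2 * (E' * (E t)ᴴ).trace.re) t := by
  have h : HasDerivAt (fun u => ∑ i, ∑ j, ‖E u i j‖ ^ 2)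
      (∑ i, ∑ j, 2 * inner ℝ (E t i j) (E' i j)) t :=
    HasDerivAt.fun_sum fun i _ => HasDerivAt.fun_sum fun j _ => (hE i j).norm_sq
  refine h.congr_deriv ?_
  simp [Matrix.trace, Matrix.mul_apply, Finset.mul_sum, Complex.inner]

theorem hasDerivAt_phiR {r : ℕ} (Mt Kt : Matrix (Fin r) (Fin r) ℂ) (s : ℂ) (α β : ℝ)
    (i j : Fin r) :
    HasDerivAt (fun a : ℝ => phiR Mt Kt s a β i j) ((s • Mt) i j) α := by
  have h := (((hasDerivAt_id α).ofReal_comp.const_mul s).const_add (s ^ 2)).mul_const (Mt i j)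
  simpa [phiR] using h.add_const ((1 + s * (β : ℂ)) * Kt i j)

/-- Left and right multiplication by constant matrices preserve entrywise derivatives. -/
theorem hasDerivAt_matrix_mul_mul_apply {l m n o : Type*} [Fintype m] [Fintype n]
    {X : ℝ → Matrix m n ℂ} {X' : Matrix m n ℂ} {t : ℝ}
    (hX : ∀ i j, HasDerivAt (fun u => X u i j) (X' i j) t)
    (C : Matrix l m ℂ) (B : Matrix n o ℂ) (i : l) (j : o) :
    HasDerivAt (fun u => (C * X u * B) i j) ((C * X' * B) i j) t := by
  simp only [Matrix.mul_apply]
  exact HasDerivAt.fun_sum fun k _ =>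
    (HasDerivAt.fun_sum fun l _ => (hX l k).const_mul _).mul_const _

/-- Gradient of the least-squares objective with respect to the Rayleigh damping
coefficient `α` (Theorem 5.1, formula (5.5a)). -/
theorem deriv_J_alpha {r m p : ℕ} (Mt Kt : Matrix (Fin r) (Fin r) ℂ)
    (Bt : Matrix (Fin r) (Fin m) ℂ) (Cpt Cvt : Matrix (Fin p) (Fin r) ℂ)
    (gk : Matrix (Fin p) (Fin m) ℂ) (sk : ℂ) (α β : ℝ)
    (hinv : IsUnit (phiR Mt Kt sk α β)) :
    HasDerivAt (fun a : ℝ => frobNormSq (gk - Cout Cpt Cvt sk * (phiR Mt Kt sk a β)⁻¹ * Bt))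
      (2 * (sk * Matrix.trace (Mt * (phiR Mt Kt sk α β)⁻¹ * Bt *
          (gk - Cout Cpt Cvt sk * (phiR Mt Kt sk α β)⁻¹ * Bt)ᴴ *
          Cout Cpt Cvt sk * (phiR Mt Kt sk α β)⁻¹)).re)
      α := by
  have hE (i : Fin p) (j : Fin m) :=
    (hasDerivAt_matrix_mul_mul_apply
      (X' := -((phiR Mt Kt sk α β)⁻¹ * (sk • Mt) * (phiR Mt Kt sk α β)⁻¹))
      (fun k l => hasDerivAt_matrix_inv_apply (hasDerivAt_phiR Mt Kt sk α β) hinv k l)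
      (Cout Cpt Cvt sk) Bt i j).const_sub (gk i j)
  refine (hasDerivAt_frobNormSq (E := fun a => gk - Cout Cpt Cvt sk * (phiR Mt Kt sk a β)⁻¹ * Bt)
    (E' := -(Cout Cpt Cvt sk *
      -((phiR Mt Kt sk α β)⁻¹ * (sk • Mt) * (phiR Mt Kt sk α β)⁻¹) * Bt)) hE).congr_deriv ?_
  congr 2
  simp only [Matrix.mul_neg, Matrix.neg_mul, neg_neg, Matrix.mul_smul, Matrix.smul_mul,
    Matrix.trace_smul, smul_eq_mul]
  congr 1
  simpa only [Matrix.mul_assoc] using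
    Matrix.trace_mul_comm (Cout Cpt Cvt sk * (phiR Mt Kt sk α β)⁻¹)
      (Mt * (phiR Mt Kt sk α β)⁻¹ * Bt *
        (gk - Cout Cpt Cvt sk * (phiR Mt Kt sk α β)⁻¹ * Bt)ᴴ)
end

section
/- Let M, K ∈ ℂ^{n×n}, B ∈ ℂ^{n×m}, C_p ∈ ℂ^{p×n}, let α, β ∈ ℝ with α, β ≥ 0, and define φ(s) = (s² + sα)M + (1 + sβ)K, d(s) = 1 + sβ, n(s) = s² + sα, h(s) = n(s)/d(s), and G(s) = C_p φ(s)⁻¹ B. Let λ, μ ∈ ℂ with d(λ) ≠ 0, d(μ) ≠ 0, h(λ) ≠ h(μ), and φ(λ), φ(μ) invertible, and define the second-order Loewner and shifted Loewner blocks 𝕃 = (d(λ)G(λ) − d(μ)G(μ))/(h(λ) − h(μ)) and 𝕃ˢ = (n(λ)G(λ) − n(μ)G(μ))/(h(λ) − h(μ)). Then C_p φ(λ)⁻¹ M φ(μ)⁻¹ B = −(d(λ)d(μ))⁻¹ · 𝕃 and C_p φ(λ)⁻¹ K φ(μ)⁻¹ B = (d(λ)d(μ))⁻¹ · 𝕃ˢ;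 that is, the data matrices 𝕄 and 𝕂 of quadrature-based second-order balanced truncation are diagonal rescalings of the second-order Loewner and shifted Loewner matrices. -/
open Matrix

/-- Rayleigh-damped resolvent pencil `φ(s) = (s² + sα)M + (1 + sβ)K`. -/
noncomputable def phiRay {n : ℕ} (M K : Matrix (Fin n) (Fin n) ℂ) (α β : ℝ) (s : ℂ) :
    Matrix (Fin n) (Fin n) ℂ :=
  (s ^ 2 + s * (α : ℂ)) • M + (1 + s * (β : ℂ)) • K

/-- `d(s) = 1 + sβ`. -/
noncomputable def dRay (β : ℝ) (s : ℂ) : ℂ := 1 + s * (β : ℂ)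

/-- `n(s) = s² + sα`. -/
noncomputable def nRay (α : ℝ) (s : ℂ) : ℂ := s ^ 2 + s * (α : ℂ)

/-- `h(s) = n(s)/d(s)`. -/
noncomputable def hRay (α β : ℝ) (s : ℂ) : ℂ := nRay α s / dRay β s

/-- Transfer function `G(s) = C_p φ(s)⁻¹ B` (position-only output). -/
noncomputable def GRay {n m p : ℕ} (M K : Matrix (Fin n) (Fin n) ℂ)
    (B : Matrix (Fin n) (Fin m) ℂ) (Cp : Matrix (Fin p) (Fin n) ℂ)
    (α β : ℝ) (s : ℂ) : Matrix (Fin p) (Fin m) ℂ :=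
  Cp * (phiRay M K α β s)⁻¹ * B

/-- Weighted resolvent identity for matrix inverses. -/
lemma Matrix.smul_inv_sub_smul_inv {ι R : Type*} [Fintype ι] [DecidableEq ι] [CommRing R]
    {P Q : Matrix ι ι R} (hP : IsUnit P) (hQ : IsUnit Q) (a b : R) :
    a • P⁻¹ - b • Q⁻¹ = P⁻¹ * (a • Q - b • P) * Q⁻¹ := by
  rw [Matrix.isUnit_iff_isUnit_det] at hP hQ
  simp only [mul_sub, sub_mul, Matrix.mul_smul, Matrix.smul_mul, mul_assoc,
    Matrix.mul_nonsing_inv Q hQ, Matrix.nonsing_inv_mul_cancel_left P _ hP, mul_one]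

/-- Left and right multiples of the weighted resolvent identity, when the weighted difference
of the two pencils is a multiple of a single matrix. -/
lemma Matrix.smul_mul_inv_mul_sub {ι κ τ R : Type*} [Fintype ι] [DecidableEq ι] [CommRing R]
    {P Q X : Matrix ι ι R} (hP : IsUnit P) (hQ : IsUnit Q) {a b c : R}
    (h : a • Q - b • P = c • X) (C : Matrix κ ι R) (B : Matrix ι τ R) :
    a • (C * P⁻¹ * B) - b • (C * Q⁻¹ * B) = c • (C * P⁻¹ * X * Q⁻¹ * B) := by
  have key := congrArg (fun Y => C * Y * B) (Matrix.smul_inv_sub_smul_inv hP hQ a b)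
  simpa only [h, Matrix.mul_sub, Matrix.sub_mul, Matrix.mul_smul, Matrix.smul_mul,
    Matrix.mul_assoc] using key

/-- Relation between the `soQuadpvBT` data matrices and the second-order
Loewner and shifted Loewner matrices (Remark 3.3): the quantities
`C_p φ(λ)⁻¹ M φ(μ)⁻¹ B` and `C_p φ(λ)⁻¹ K φ(μ)⁻¹ B` are diagonal rescalings
of `𝕃 = (d(λ)G(λ) − d(μ)G(μ))/(h(λ) − h(μ))` and
`𝕃ˢ = (n(λ)G(λ) − n(μ)G(μ))/(h(λ) − h(μ))`, respectively. -/
theorem loewner_rescaling {n m p : ℕ} (M K : Matrix (Fin n) (Fin n) ℂ)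
    (B : Matrix (Fin n) (Fin m) ℂ) (Cp : Matrix (Fin p) (Fin n) ℂ)
    (α β : ℝ) (hα : 0 ≤ α) (hβ : 0 ≤ β) (lam mu : ℂ)
    (hdl : dRay β lam ≠ 0) (hdm : dRay β mu ≠ 0)
    (hh : hRay α β lam ≠ hRay α β mu)
    (hl : IsUnit (phiRay M K α β lam)) (hm : IsUnit (phiRay M K α β mu)) :
    Cp * (phiRay M K α β lam)⁻¹ * M * (phiRay M K α β mu)⁻¹ * B =
      (-(dRay β lam * dRay β mu)⁻¹) •
        ((hRay α β lam - hRay α β mu)⁻¹ •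
          (dRay β lam • GRay M K B Cp α β lam - dRay β mu • GRay M K B Cp α β mu)) ∧
    Cp * (phiRay M K α β lam)⁻¹ * K * (phiRay M K α β mu)⁻¹ * B =
      (dRay β lam * dRay β mu)⁻¹ •
        ((hRay α β lam - hRay α β mu)⁻¹ •
          (nRay α lam • GRay M K B Cp α β lam - nRay α mu • GRay M K B Cp α β mu)) := by
  have hsub : hRay α β lam - hRay α β mu ≠ 0 := sub_ne_zero.mpr hh
  have hdiff : dRay β lam * dRay β mu * (hRay α β lam - hRay α β mu) =
      nRay α lam * dRay β mu - nRay α mu * dRay β lam := by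
    unfold hRay
    field_simp
  have hM : dRay β lam • phiRay M K α β mu - dRay β mu • phiRay M K α β lam =
      (-(dRay β lam * dRay β mu * (hRay α β lam - hRay α β mu))) • M := by
    rw [hdiff]
    unfold phiRay dRay nRay
    module
  have hK : nRay α lam • phiRay M K α β mu - nRay α mu • phiRay M K α β lam =
      (dRay β lam * dRay β mu * (hRay α β lam - hRay α β mu)) • K := by
    rw [hdiff]
    unfold phiRay dRay nRay
    module
  unfold GRay
  rw [Matrix.smul_mul_inv_mul_sub hl hm hM, Matrix.smul_mul_inv_mul_sub hl hm hK]
  simp only [smul_smul]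
  constructor
  · rw [eq_comm]
    convert one_smul ℂ _ using 2
    field_simp
  · rw [eq_comm]
    convert one_smul ℂ _ using 2
    field_simp
end
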